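/- arXiv:2207.13990 — 6 statements merged into one kernel-verified Lean document; each statement's English description precedes it below -/
import Mathlib

section
/- If an infinite compact Hausdorff space K has the Grothendieck property, then K does not have the finitely supported Josefson–Nissenzweig property; that is, there is no sequence ⟨μ_n⟩ of finitely supported signed Radon measures on K with ‖μ_n‖ = 1 for every n converging weak* to 0. -/
open MeasureTheory Filter Topology Set
open scoped ENNReal

namespace JNP

variable {K : Type*} [TopologicalSpace K] [MeasurableSpace K] [BorelSpace K]

/-- The total variation norm of a signed Borel measure. -/
noncomputable def tvNorm (μ : SignedMeasure K) : ℝ :=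
  (μ.totalVariation Set.univ).toReal

/-- A signed Borel measure is Radon if its total variation is a regular measure. -/
def IsRadon (μ : SignedMeasure K) : Prop :=
  μ.totalVariation.Regular

/-- The integral of a function against a signed measure. -/
noncomputable def integ (μ : SignedMeasure K) (f : K → ℝ) : ℝ :=
  ∫ x, f x ∂μ.toJordanDecomposition.posPart -
    ∫ x, f x ∂μ.toJordanDecomposition.negPart

/-- The support of a signed measure: the set of points all of whose open
neighbourhoods have nonzero total variation. -/
def msupport (μ : SignedMeasure K) : Set K :=
  {x : K | ∀ U : Set K, IsOpen U → x ∈ U → μ.totalVariation U ≠ 0}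

/-- Weak* convergence of a sequence of signed measures: convergence of the integrals of
every continuous real-valued function. -/
def WeakStarTendsto (μs : ℕ → SignedMeasure K) (μ : SignedMeasure K) : Prop :=
  ∀ f : C(K, ℝ), Tendsto (fun n => integ (μs n) f) atTop (𝓝 (integ μ f))

/-- A sequence of signed measures is weak* null if the integral of every continuous
real-valued function tends to `0`. -/
def WeakStarNull (μs : ℕ → SignedMeasure K) : Prop :=
  ∀ f : C(K, ℝ), Tendsto (fun n => integ (μs n) f) atTop (𝓝 (0 : ℝ))

/-- Weak convergence of a sequence of signed measures: convergence under every bounded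
linear functional on the Banach space of signed measures with the total variation norm
(which, for Radon measures, is `C(K)*` by the Riesz representation theorem). -/
def WeakTendsto (μs : ℕ → SignedMeasure K) (μ : SignedMeasure K) : Prop :=
  ∀ φ : SignedMeasure K →ₗ[ℝ] ℝ,
    (∃ C : ℝ, ∀ ν : SignedMeasure K, |φ ν| ≤ C * tvNorm ν) →
    Tendsto (fun n => φ (μs n)) atTop (𝓝 (φ μ))

variable (K) in
/-- The Grothendieck property: every weak* convergent sequence of signed Radon measures
is weakly convergent. -/
def GrothendieckProp : Prop :=
  ∀ (μs : ℕ → SignedMeasure K) (μ : SignedMeasure K),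
    (∀ n, IsRadon (μs n)) → IsRadon μ → WeakStarTendsto μs μ → WeakTendsto μs μ

variable (K) in
/-- The ℓ₁-Grothendieck property: every weak* convergent sequence of countably supported
signed Radon measures is weakly convergent. -/
def Ell1Grothendieck : Prop :=
  ∀ (μs : ℕ → SignedMeasure K) (μ : SignedMeasure K),
    (∀ n, IsRadon (μs n)) → (∀ n, (msupport (μs n)).Countable) →
    IsRadon μ → WeakStarTendsto μs μ → WeakTendsto μs μ

variable (K) in
/-- The Δ-Grothendieck property: every weak* convergent sequence of finitely supported
signed Radon measures is weakly convergent. -/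
def DeltaGrothendieck : Prop :=
  ∀ (μs : ℕ → SignedMeasure K) (μ : SignedMeasure K),
    (∀ n, IsRadon (μs n)) → (∀ n, (msupport (μs n)).Finite) →
    IsRadon μ → WeakStarTendsto μs μ → WeakTendsto μs μ

variable (K) in
/-- The finitely supported Josefson–Nissenzweig property: there is a weak* null sequence of
finitely supported signed Radon measures of total variation norm one. -/
def fsJNP : Prop :=
  ∃ μs : ℕ → SignedMeasure K,
    (∀ n, IsRadon (μs n)) ∧ (∀ n, (msupport (μs n)).Finite) ∧
    (∀ n, tvNorm (μs n) = 1) ∧ WeakStarNull μs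

variable (K) in
/-- The countably supported Josefson–Nissenzweig property: there is a weak* null sequence of
countably supported signed Radon measures of total variation norm one. -/
def csJNP : Prop :=
  ∃ μs : ℕ → SignedMeasure K,
    (∀ n, IsRadon (μs n)) ∧ (∀ n, (msupport (μs n)).Countable) ∧
    (∀ n, tvNorm (μs n) = 1) ∧ WeakStarNull μs

end JNP

/-- Schur's lemma for finitely supported families: if the sums over every set of indices tend
to zero, then the `ℓ¹` norms tend to zero. -/
theorem tendsto_sum_abs_of_tendsto_sum_indicator {ι : Type*} (F : ℕ → Finset ι) (a : ℕ → ι → ℝ)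
    (ha : ∀ n x, x ∉ F n → a n x = 0)
    (h : ∀ A : Set ι, Tendsto (fun n => ∑ x ∈ F n, A.indicator (a n) x) atTop (𝓝 0)) :
    Tendsto (fun n => ∑ x ∈ F n, |a n x|) atTop (𝓝 0) := by
  classical
  have hpt (x : ι) : Tendsto (fun n => |a n x|) atTop (𝓝 0) := by
    have hx := (h {x}).abs
    rw [abs_zero] at hx
    refine hx.congr fun n => ?_
    congr 1
    by_cases hxn : x ∈ F n
    · rw [Finset.sum_eq_single_of_mem x hxn (fun y _ hy => by simp [hy])]
      simp
    · rw [ha n x hxn]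
      refine Finset.sum_eq_zero fun y hy => ?_
      have : y ≠ x := fun e => hxn (e ▸ hy)
      simp [this]
  rw [Metric.tendsto_atTop]
  intro ε hε
  let φ : ℕ → (ι → Bool) → ℝ := fun n A => ∑ x ∈ F n, if A x then a n x else 0
  have hφ (n : ℕ) : Continuous (φ n) := by
    refine continuous_finsetSum _ fun x _ => ?_
    exact (continuous_of_discreteTopology (f := fun b : Bool => if b then a n x else 0)).comp
      (continuous_apply x)
  let C : ℕ → Set (ι → Bool) := fun N => {A | ∀ n ≥ N, |φ n A| ≤ ε / 4}
  have hC (N : ℕ) : IsClosed (C N) := by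
    simp only [C, ofPred_forall]
    exact isClosed_iInter fun n => isClosed_iInter fun _ =>
      isClosed_le (hφ n).abs continuous_const
  have hU : ⋃ N, C N = univ := by
    refine eq_univ_of_forall fun A => mem_iUnion.2 ?_
    obtain ⟨N, hN⟩ := Metric.tendsto_atTop.1 (h {x | A x = true}) (ε / 4) (by positivity)
    refine ⟨N, fun n hn => ?_⟩
    have := (hN n hn).le
    simpa [φ, Real.dist_eq, indicator_apply] using this
  obtain ⟨N, A, hA⟩ := nonempty_interior_of_iUnion_of_closed hC hU
  obtain ⟨G, u, hu, hGu⟩ := isOpen_pi_iff.1 isOpen_interior A hA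
  have hagree (B : ι → Bool) (hB : ∀ x ∈ G, B x = A x) : B ∈ C N :=
    interior_subset <| hGu fun x hx => by
      rw [hB x hx]
      exact (hu x hx).2
  have hG : Tendsto (fun n => ∑ x ∈ G, |a n x|) atTop (𝓝 0) := by
    simpa using tendsto_finsetSum G fun x _ => hpt x
  obtain ⟨M, hM⟩ := Metric.tendsto_atTop.1 hG (ε / 4) (by positivity)
  refine ⟨max N M, fun n hn => ?_⟩
  have hGn := hM n (le_of_max_le_right hn)
  rw [Real.dist_eq, sub_zero, abs_of_nonneg (Finset.sum_nonneg fun _ _ => abs_nonneg _)] at hGn ⊢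
  have hP := hagree (fun x => if x ∈ G then A x else decide (0 < a n x))
    (fun x hx => by simp [hx]) n (le_of_max_le_left hn)
  have hQ := hagree (fun x => if x ∈ G then A x else decide (a n x < 0))
    (fun x hx => by simp [hx]) n (le_of_max_le_left hn)
  have hsplit : ∑ x ∈ F n, |a n x| ≤ ∑ x ∈ F n, (if x ∈ G then |a n x| else 0) +
      (φ n (fun x => if x ∈ G then A x else decide (0 < a n x)) -
        φ n (fun x => if x ∈ G then A x else decide (a n x < 0))) := by
    simp only [φ]
    rw [← Finset.sum_sub_distrib, ← Finset.sum_add_distrib]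
    refine Finset.sum_le_sum fun x _ => ?_
    by_cases hx : x ∈ G
    · simp [hx]
    · rcases lt_trichotomy (a n x) 0 with h0 | h0 | h0
      · simp [hx, h0, h0.not_gt, abs_of_neg]
      · simp [hx, h0]
      · simp [hx, h0, h0.not_gt, abs_of_pos]
  have hle : ∑ x ∈ F n, (if x ∈ G then |a n x| else 0) ≤ ∑ x ∈ G, |a n x| := by
    rw [← Finset.sum_filter]
    exact Finset.sum_le_sum_of_subset_of_nonneg (fun x hx => (Finset.mem_filter.1 hx).2)
      fun _ _ _ => abs_nonneg _
  linarith [abs_le.1 hP, abs_le.1 hQ]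

namespace JNP

variable {K : Type*} [MeasurableSpace K]

theorem apply_eq_real_sub_real (μ : SignedMeasure K) {A : Set K} (hA : MeasurableSet A) :
    μ A = μ.toJordanDecomposition.posPart.real A - μ.toJordanDecomposition.negPart.real A := by
  conv_lhs => rw [← μ.toSignedMeasure_toJordanDecomposition]
  rw [JordanDecomposition.toSignedMeasure, sub_apply,
    Measure.toSignedMeasure_apply_measurable hA, Measure.toSignedMeasure_apply_measurable hA]

theorem real_totalVariation (μ : SignedMeasure K) (A : Set K) :
    (μ.totalVariation A).toReal =
      μ.toJordanDecomposition.posPart.real A + μ.toJordanDecomposition.negPart.real A := by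
  rw [SignedMeasure.totalVariation, Measure.add_apply,
    ENNReal.toReal_add (measure_ne_top _ _) (measure_ne_top _ _)]
  rfl

theorem abs_apply_le_totalVariation (μ : SignedMeasure K) {A : Set K} (hA : MeasurableSet A) :
    |μ A| ≤ (μ.totalVariation A).toReal := by
  rw [apply_eq_real_sub_real μ hA, real_totalVariation, abs_le]
  constructor <;> linarith [measureReal_nonneg (μ := μ.toJordanDecomposition.posPart) (s := A),
    measureReal_nonneg (μ := μ.toJordanDecomposition.negPart) (s := A)]

theorem totalVariation_singleton [MeasurableSingletonClass K] (μ : SignedMeasure K) (x : K) :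
    (μ.totalVariation {x}).toReal = |μ {x}| := by
  rw [apply_eq_real_sub_real μ (measurableSet_singleton x), real_totalVariation]
  obtain ⟨s, -, hp, hn⟩ := μ.toJordanDecomposition.mutuallySingular
  by_cases hx : x ∈ s
  · have : μ.toJordanDecomposition.posPart {x} = 0 :=
      measure_mono_null (singleton_subset_iff.2 hx) hp
    simp [measureReal_def, this]
  · have : μ.toJordanDecomposition.negPart {x} = 0 :=
      measure_mono_null (singleton_subset_iff.2 hx) hn
    simp [measureReal_def, this]

theorem abs_apply_le_tvNorm [TopologicalSpace K] [BorelSpace K] (μ : SignedMeasure K) {A : Set K} (hA : MeasurableSet A) :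
    |μ A| ≤ tvNorm μ := by
  refine (abs_apply_le_totalVariation μ hA).trans ?_
  rw [tvNorm, real_totalVariation, real_totalVariation]
  exact add_le_add (measureReal_mono (subset_univ A)) (measureReal_mono (subset_univ A))

theorem apply_eq_sum_indicator [MeasurableSingletonClass K] (μ : SignedMeasure K)
    {F : Finset K} (hF : μ.totalVariation (F : Set K)ᶜ = 0) {A : Set K} (hA : MeasurableSet A) :
    μ A = ∑ x ∈ F, A.indicator (fun y => μ {y}) x := by
  classical
  have hdiff : μ (A \ F) = 0 := by
    have h0 : μ.totalVariation (A \ F) = 0 :=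
      measure_mono_null (fun x hx => hx.2) hF
    have := abs_apply_le_totalVariation μ (hA.diff F.measurableSet)
    rw [h0, ENNReal.toReal_zero] at this
    exact abs_nonpos_iff.1 this
  have hfin (G : Finset K) : μ (G : Set K) = ∑ x ∈ G, μ {x} := by
    rw [apply_eq_real_sub_real μ G.measurableSet, ← sum_measureReal_singleton,
      ← sum_measureReal_singleton, ← Finset.sum_sub_distrib]
    exact Finset.sum_congr rfl fun x _ =>
      (apply_eq_real_sub_real μ (measurableSet_singleton x)).symm
  have hsplit : μ A = μ (A ∩ F) + μ (A \ F) := by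
    rw [← VectorMeasure.of_union (disjoint_sdiff_right.mono_left inter_subset_right)
      (hA.inter F.measurableSet) (hA.diff F.measurableSet), inter_union_sdiff]
  have hinter : A ∩ F = ((F.filter (· ∈ A) : Finset K) : Set K) := by
    ext x
    simp [and_comm]
  rw [hsplit, hdiff, add_zero, hinter, hfin, Finset.sum_filter]
  rfl

theorem tvNorm_eq_sum [TopologicalSpace K] [BorelSpace K] [MeasurableSingletonClass K]
    (μ : SignedMeasure K) {F : Finset K} (hF : μ.totalVariation (F : Set K)ᶜ = 0) : tvNorm μ = ∑ x ∈ F, |μ {x}| := by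
  have huniv : μ.totalVariation univ = μ.totalVariation (F : Set K) := by
    refine le_antisymm ?_ (measure_mono (subset_univ _))
    rw [← union_compl_self (F : Set K)]
    exact (measure_union_le _ _).trans (by rw [hF, add_zero])
  rw [tvNorm, huniv, real_totalVariation, ← sum_measureReal_singleton,
    ← sum_measureReal_singleton, ← Finset.sum_add_distrib]
  refine Finset.sum_congr rfl fun x _ => ?_
  rw [← totalVariation_singleton, real_totalVariation]

theorem totalVariation_compl_msupport [TopologicalSpace K] [BorelSpace K] {μ : SignedMeasure K}
    (hμ : IsRadon μ) (hs : IsClosed (msupport μ)) : μ.totalVariation (msupport μ)ᶜ = 0 := by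
  have hreg : μ.totalVariation.Regular := hμ
  rw [hreg.innerRegular.measure_eq_iSup hs.isOpen_compl]
  simp only [ENNReal.iSup_eq_zero]
  intro L hL hLc
  refine hLc.measure_zero_of_nhdsWithin fun x hx => ?_
  have hx' : x ∉ msupport μ := hL hx
  simp only [msupport, mem_ofPred_eq, not_forall, not_not] at hx'
  obtain ⟨U, hU, hxU, h0⟩ := hx'
  exact ⟨U, mem_nhdsWithin_of_mem_nhds (hU.mem_nhds hxU), h0⟩

theorem WeakTendsto.tendsto_apply [TopologicalSpace K] [BorelSpace K]
    {μs : ℕ → SignedMeasure K} {μ : SignedMeasure K}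
    (h : WeakTendsto μs μ) {A : Set K} (hA : MeasurableSet A) :
    Tendsto (fun n => μs n A) atTop (𝓝 (μ A)) :=
  h { toFun := fun ν => ν A
      map_add' := fun _ _ => rfl
      map_smul' := fun _ _ => rfl }
    ⟨1, fun ν => (abs_apply_le_tvNorm ν hA).trans_eq (one_mul _).symm⟩

end JNP

/-- If an infinite compact Hausdorff space has the Grothendieck property, then it does not
have the finitely supported Josefson–Nissenzweig property. -/
theorem stmt_9 (K : Type*) [TopologicalSpace K] [MeasurableSpace K] [BorelSpace K]
    [CompactSpace K] [T2Space K] [Infinite K] (h : JNP.GrothendieckProp K) :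
    ¬ JNP.fsJNP K := by
  rintro ⟨μs, hrad, hfin, hnorm, hnull⟩
  have hzero : JNP.IsRadon (0 : SignedMeasure K) := by
    rw [JNP.IsRadon, SignedMeasure.totalVariation_zero]
    infer_instance
  have hweak : JNP.WeakTendsto μs 0 := h μs 0 hrad hzero fun f => by
    simpa [JNP.integ, SignedMeasure.toJordanDecomposition_zero] using hnull f
  let F : ℕ → Finset K := fun n => (hfin n).toFinset
  have hF (n : ℕ) : (μs n).totalVariation (F n : Set K)ᶜ = 0 := by
    rw [Finite.coe_toFinset]
    exact JNP.totalVariation_compl_msupport (hrad n) (hfin n).isClosed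
  have hS : (⋃ n, (F n : Set K)).Countable := countable_iUnion fun n => (F n).countable_toSet
  have hlim := tendsto_sum_abs_of_tendsto_sum_indicator F (fun n x => μs n {x})
    (fun n x hx => by
      have h0 : (μs n).totalVariation {x} = 0 :=
        measure_mono_null (singleton_subset_iff.2 hx) (hF n)
      rw [← abs_eq_zero, ← JNP.totalVariation_singleton, h0, ENNReal.toReal_zero])
    (fun A => by
      have hA : MeasurableSet (A ∩ ⋃ n, (F n : Set K)) :=
        (hS.mono inter_subset_right).measurableSet
      refine (hweak.tendsto_apply hA).congr fun n => ?_
      rw [JNP.apply_eq_sum_indicator (μs n) (hF n) hA]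
      refine Finset.sum_congr rfl fun x hx => ?_
      have hxS : x ∈ ⋃ n, (F n : Set K) := mem_iUnion.2 ⟨n, hx⟩
      by_cases hxA : x ∈ A <;> simp [hxA, hxS])
  have hone (n : ℕ) : ∑ x ∈ F n, |μs n {x}| = 1 := by
    rw [← JNP.tvNorm_eq_sum (μs n) (hF n), hnorm n]
  simp only [hone] at hlim
  exact one_ne_zero (tendsto_nhds_unique tendsto_const_nhds hlim)
end

section
/- Let μ be a uniformly regular Radon probability measure on a compact Hausdorff space K and let x ∈ K satisfy μ({x}) > 0. Then x is a Gδ-point of K, i.e. {x} is the intersection of a countable family of open subsets of K. -/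
open MeasureTheory Filter Topology Set
open scoped ENNReal

/-- A subset of a topological space is a zero set if it is the preimage of `{0}` under a
continuous real-valued function. -/
def IsZeroSet {X : Type*} [TopologicalSpace X] (A : Set X) : Prop :=
  ∃ f : C(X, ℝ), A = f ⁻¹' {0}

/-- A measure `μ` is uniformly regular if there is a countable family `𝒞` of zero sets such
that every open set `U` contains some `F ∈ 𝒞` with `μ (U \ F)` arbitrarily small. -/
def UniformlyRegular {X : Type*} [TopologicalSpace X] [MeasurableSpace X]
    (μ : Measure X) : Prop :=
  ∃ 𝒞 : Set (Set X), 𝒞.Countable ∧ (∀ F ∈ 𝒞, IsZeroSet F) ∧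
    ∀ U : Set X, IsOpen U → ∀ ε : ℝ≥0∞, 0 < ε → ∃ F ∈ 𝒞, F ⊆ U ∧ μ (U \ F) < ε

/-- If `μ` is a uniformly regular Radon probability measure on a compact Hausdorff space `K`
and `μ {x} > 0`, then `x` is a Gδ-point. -/
theorem stmt_11 {K : Type*} [TopologicalSpace K] [MeasurableSpace K] [BorelSpace K]
    [CompactSpace K] [T2Space K]
    (μ : Measure K) [IsProbabilityMeasure μ] [μ.Regular]
    (hur : UniformlyRegular μ) (x : K) (hx : 0 < μ {x}) :
    ∃ U : ℕ → Set K, (∀ n, IsOpen (U n)) ∧ {x} = ⋂ n, U n := by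
  obtain ⟨𝒞, h𝒞, hzero, happrox⟩ := hur
  have hsingle : {x} = ⋂ F ∈ {F ∈ 𝒞 | x ∈ F}, F := by
    refine Subset.antisymm ?_ fun y hy => ?_
    · rintro _ rfl
      exact mem_iInter₂.2 fun F hF => hF.2
    · by_contra hyx
      obtain ⟨F, hF, hFy, hμ⟩ := happrox {y}ᶜ isOpen_compl_singleton _ hx
      have hxF : x ∈ F := by
        by_contra hxF
        refine hμ.not_ge (measure_mono (singleton_subset_iff.2 ⟨fun h => hyx ?_, hxF⟩))
        exact (mem_singleton_iff.1 h).symm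
      exact hFy (mem_iInter₂.1 hy F ⟨hF, hxF⟩) rfl
  have hGδ : IsGδ {x} := by
    rw [hsingle]
    refine IsGδ.biInter (h𝒞.mono (sep_subset _ _)) fun F hF => ?_
    obtain ⟨f, rfl⟩ := hzero F hF.1
    exact (IsGδ.singleton 0).preimage f.continuous
  exact isGδ_iff_eq_iInter_nat.1 hGδ
end

section
/- If μ is a non-atomic uniformly regular Radon probability measure on a compact Hausdorff space K, then μ admits a uniformly distributed injective sequence; that is, there exists a sequence ⟨x_n⟩ of pairwise distinct points of K such that the averages (1/n) Σ_{i=0}^{n−1} δ_{x_i} converge weak* to μ. -/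
open MeasureTheory Filter Topology Set
open scoped ENNReal

/-- Two distinct coordinates of a random sequence with a non-atomic outer regular law on a
Lindelöf space almost surely differ. The diagonal need not be measurable; a countable partition
into sets of small measure bounds its outer measure. -/
theorem measure_eval_eq_eval_infinitePi_eq_zero {K : Type*} [TopologicalSpace K]
    [MeasurableSpace K] [OpensMeasurableSpace K] [LindelofSpace K] (μ : Measure K)
    [IsProbabilityMeasure μ] [μ.OuterRegular] (hna : ∀ x : K, μ {x} = 0) {i j : ℕ}
    (hij : i ≠ j) :
    Measure.infinitePi (fun _ : ℕ => μ) {ω | ω i = ω j} = 0 := by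
  refine le_antisymm (le_of_forall_pos_le_add fun ε hε => ?_) zero_le
  rw [zero_add]
  have hsmall : ∀ x : K, ∃ U : Set K, x ∈ U ∧ IsOpen U ∧ μ U < ε := fun x => by
    obtain ⟨U, hxU, hU, hμU⟩ := ({x} : Set K).exists_isOpen_lt_of_lt ε (by rwa [hna x])
    exact ⟨U, hxU rfl, hU, hμU⟩
  choose U hxU hU hμU using hsmall
  obtain ⟨t, htc, ht⟩ := LindelofSpace.elim_nhds_subcover U fun x => (hU x).mem_nhds (hxU x)
  obtain ⟨V, hV⟩ : ∃ V : ℕ → Set K, (∀ n, MeasurableSet (V n) ∧ μ (V n) ≤ ε) ∧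
      ⋃ n, V n = univ := by
    rcases t.eq_empty_or_nonempty with rfl | hne
    · exact ⟨fun _ => ∅, by simp, by simpa using ht⟩
    · obtain ⟨e, rfl⟩ := htc.exists_eq_range hne
      exact ⟨fun n => U (e n), fun n => ⟨(hU _).measurableSet, (hμU _).le⟩,
        by simpa using ht⟩
  obtain ⟨hV, hVu⟩ := hV
  have hPm : ∀ n, MeasurableSet (disjointed V n) := .disjointed fun n => (hV n).1
  have hsub : {ω : ℕ → K | ω i = ω j} ⊆
      ⋃ n, Set.pi ({i, j} : Finset ℕ) fun _ => disjointed V n := fun ω hω => by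
    have : ω i ∈ ⋃ n, disjointed V n := by rw [iUnion_disjointed, hVu]; trivial
    obtain ⟨n, hn⟩ := mem_iUnion.1 this
    have hω : ω i = ω j := hω
    exact mem_iUnion.2 ⟨n, by simpa [← hω] using hn⟩
  calc Measure.infinitePi (fun _ : ℕ => μ) {ω | ω i = ω j}
      ≤ ∑' n, Measure.infinitePi (fun _ : ℕ => μ)
          (Set.pi ({i, j} : Finset ℕ) fun _ => disjointed V n) :=
        (measure_mono hsub).trans (measure_iUnion_le _)
    _ = ∑' n, μ (disjointed V n) * μ (disjointed V n) := by
        congr with n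
        rw [Measure.infinitePi_pi _ fun _ _ => hPm n, Finset.prod_pair hij]
    _ ≤ ∑' n, ε * μ (disjointed V n) := by
        gcongr with n
        exact (measure_mono (disjointed_subset V n)).trans (hV n).2
    _ = ε := by
        rw [ENNReal.tsum_mul_left, ← measure_iUnion (disjoint_disjointed V) hPm,
          iUnion_disjointed, hVu, measure_univ, mul_one]

/-- Almost every sequence visits a measurable set with the right asymptotic frequency. -/
theorem ae_tendsto_frequency_infinitePi {K : Type*} [MeasurableSpace K] (μ : Measure K)
    [IsProbabilityMeasure μ] {F : Set K} (hF : MeasurableSet F) :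
    ∀ᵐ ω ∂Measure.infinitePi (fun _ : ℕ => μ),
      Tendsto (fun n : ℕ => (∑ i ∈ Finset.range n, F.indicator (1 : K → ℝ) (ω i)) / (n : ℝ))
        atTop (𝓝 (μ.real F)) := by
  have hm : Measurable (F.indicator (1 : K → ℝ)) := measurable_one.indicator hF
  have hmp := measurePreserving_eval_infinitePi (fun _ : ℕ => μ)
  have hint : Integrable (F.indicator (1 : K → ℝ)) μ := (integrable_const 1).indicator hF
  have hlaw := ProbabilityTheory.strong_law_ae_real (μ := Measure.infinitePi fun _ : ℕ => μ)
    (fun i ω => F.indicator (1 : K → ℝ) (ω i))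
    ((hmp 0).integrable_comp_of_integrable hint)
    (fun i j hij => (ProbabilityTheory.iIndepFun_infinitePi fun _ => hm).indepFun hij)
    (fun i => ProbabilityTheory.IdentDistrib.comp
      ⟨(hmp i).measurable.aemeasurable, (hmp 0).measurable.aemeasurable,
        (hmp i).map_eq.trans (hmp 0).map_eq.symm⟩ hm)
  have hval : ∫ ω, F.indicator (1 : K → ℝ) (ω 0) ∂Measure.infinitePi (fun _ : ℕ => μ)
      = μ.real F := by
    have h := integral_map (μ := Measure.infinitePi fun _ : ℕ => μ)
      (hmp 0).measurable.aemeasurable hm.aestronglyMeasurable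
    rw [(hmp 0).map_eq, integral_indicator_one hF] at h
    exact h.symm
  rwa [hval] at hlaw

/-- The uniform probability measure on the first `n + 1` terms of a sequence. -/
noncomputable def averagedDirac {K : Type*} [MeasurableSpace K] (x : ℕ → K) (n : ℕ) :
    Measure K :=
  ((n + 1 : ℕ) : ℝ≥0∞)⁻¹ • ∑ i ∈ Finset.range (n + 1), Measure.dirac (x i)

instance {K : Type*} [MeasurableSpace K] (x : ℕ → K) (n : ℕ) :
    IsProbabilityMeasure (averagedDirac x n) where
  measure_univ := by
    simpa [averagedDirac] using ENNReal.inv_mul_cancel (by simp) (by finiteness)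

theorem integral_averagedDirac {K : Type*} [MeasurableSpace K] (x : ℕ → K) (n : ℕ)
    {f : K → ℝ} (hf : StronglyMeasurable f) :
    ∫ k, f k ∂averagedDirac x n =
      (∑ i ∈ Finset.range (n + 1), f (x i)) / ((n + 1 : ℕ) : ℝ) := by
  rw [averagedDirac, integral_smul_measure,
    integral_finsetSum_measure fun i _ => integrable_dirac' hf (by simp)]
  simp_rw [integral_dirac' f _ hf]
  rw [ENNReal.toReal_inv, ENNReal.toReal_natCast, smul_eq_mul, div_eq_inv_mul]

/-- Asymptotic frequencies on a family of sets that approximates all open sets from inside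
determine the weak* limit of the averages. -/
theorem tendsto_average_of_tendsto_frequency {K : Type*} [TopologicalSpace K]
    [MeasurableSpace K] [BorelSpace K] [CompactSpace K] (μ : Measure K)
    [IsProbabilityMeasure μ] {𝒞 : Set (Set K)} (hm : ∀ F ∈ 𝒞, MeasurableSet F)
    (happrox : ∀ U : Set K, IsOpen U → ∀ ε : ℝ≥0∞, 0 < ε → ∃ F ∈ 𝒞, F ⊆ U ∧ μ (U \ F) < ε)
    {x : ℕ → K}
    (hx : ∀ F ∈ 𝒞, Tendsto
      (fun n : ℕ => (∑ i ∈ Finset.range n, F.indicator (1 : K → ℝ) (x i)) / (n : ℝ))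
      atTop (𝓝 (μ.real F)))
    (f : C(K, ℝ)) :
    Tendsto (fun n : ℕ => (∑ i ∈ Finset.range n, f (x i)) / (n : ℝ))
      atTop (𝓝 (∫ k, f k ∂μ)) := by
  have hF : ∀ F ∈ 𝒞, Tendsto (fun n => averagedDirac x n F) atTop (𝓝 (μ F)) := fun F hF => by
    rw [← ENNReal.tendsto_toReal_iff (fun _ => measure_ne_top _ _) (measure_ne_top _ _)]
    refine ((tendsto_add_atTop_iff_nat 1).2 (hx F hF)).congr fun n => ?_
    rw [← integral_averagedDirac x n (stronglyMeasurable_one.indicator (hm F hF)),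
      integral_indicator_one (hm F hF)]
    rfl
  have hopen : ∀ U, IsOpen U → μ U ≤ liminf (fun n => averagedDirac x n U) atTop := by
    refine fun U hU => le_of_forall_pos_le_add fun ε hε => ?_
    obtain ⟨F, hFC, hFU, hε⟩ := happrox U hU ε hε
    calc μ U ≤ μ F + μ (U \ F) := by
          simpa [union_sdiff_cancel hFU] using measure_union_le (μ := μ) F (U \ F)
      _ ≤ liminf (fun n => averagedDirac x n U) atTop + ε := by
          gcongr
          rw [← (hF F hFC).liminf_eq]
          exact liminf_le_liminf (.of_forall fun n => measure_mono hFU)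
  have hweak := tendsto_of_forall_isOpen_le_liminf_nat' (μ := ⟨μ, inferInstance⟩)
    (μs := fun n => ⟨averagedDirac x n, inferInstance⟩) hopen
  refine (tendsto_add_atTop_iff_nat 1).1 ?_
  refine (ProbabilityMeasure.tendsto_iff_forall_integral_tendsto.1 hweak
    (BoundedContinuousFunction.mkOfCompact f)).congr fun n => ?_
  exact integral_averagedDirac x n f.continuous.stronglyMeasurable

/-- A non-atomic uniformly regular Radon probability measure on a compact Hausdorff space
admits a uniformly distributed injective sequence: an injective sequence `⟨x_n⟩` whose
averaged Dirac measures converge weak* to `μ`. -/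
theorem stmt_12 {K : Type*} [TopologicalSpace K] [MeasurableSpace K] [BorelSpace K]
    [CompactSpace K] [T2Space K]
    (μ : Measure K) [IsProbabilityMeasure μ] [μ.Regular]
    (hur : UniformlyRegular μ) (hna : ∀ x : K, μ {x} = 0) :
    ∃ x : ℕ → K, Function.Injective x ∧
      ∀ f : C(K, ℝ), Tendsto (fun n : ℕ => (∑ i ∈ Finset.range n, f (x i)) / (n : ℝ))
        atTop (𝓝 (∫ k, f k ∂μ)) := by
  obtain ⟨𝒞, h𝒞, hzero, happrox⟩ := hur
  have hm : ∀ F ∈ 𝒞, MeasurableSet F := fun F hF => by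
    obtain ⟨f, rfl⟩ := hzero F hF
    exact f.continuous.measurable (measurableSet_singleton 0)
  have hfreq := (ae_ball_iff h𝒞).2 fun F hF => ae_tendsto_frequency_infinitePi μ (hm F hF)
  have hinj : ∀ᵐ ω ∂Measure.infinitePi (fun _ : ℕ => μ), Function.Injective ω := by
    have : ∀ i j : ℕ, ∀ᵐ ω ∂Measure.infinitePi (fun _ : ℕ => μ), i ≠ j → ω i ≠ ω j := by
      intro i j
      by_cases hij : i = j
      · simp [hij]
      · rw [ae_iff]
        simpa [hij] using measure_eval_eq_eval_infinitePi_eq_zero μ hna hij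
    filter_upwards [ae_all_iff.2 fun i => ae_all_iff.2 (this i)] with ω hω i j h
    by_contra hij
    exact hω i j hij h
  obtain ⟨x, hx, hxinj⟩ := (hfreq.and hinj).exists
  exact ⟨x, hxinj, tendsto_average_of_tendsto_frequency μ hm happrox hx⟩
end

section
/- Let μ be a Radon probability measure on a compact Hausdorff space K and let ⟨x_n⟩ be a μ-uniformly distributed injective sequence in K. Then K has the finitely supported Josefson–Nissenzweig property: there exists a sequence ⟨μ_n⟩ of finitely supported signed Radon measures on K with total variation norm ‖μ_n‖ = 1 for every n which converges weak* to 0. -/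
open MeasureTheory Filter Topology Set
open scoped ENNReal

namespace JNP

open scoped NNReal

section

variable {K : Type*} [MeasurableSpace K]

/-- The sum of `c`-weighted point masses at the points `x i`, `i ∈ s`. -/
noncomputable def pointMasses (x : ℕ → K) (c : ℝ≥0) (s : Finset ℕ) : Measure K :=
  c • ∑ i ∈ s, Measure.dirac (x i)

instance (x : ℕ → K) (c : ℝ≥0) (s : Finset ℕ) : IsFiniteMeasure (pointMasses x c s) := by
  unfold pointMasses
  infer_instance

theorem pointMasses_univ (x : ℕ → K) (c : ℝ≥0) (s : Finset ℕ) :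
    pointMasses x c s univ = c * s.card := by
  simp only [pointMasses, Measure.smul_apply, Measure.finsetSum_apply, measure_univ,
    Finset.sum_const, nsmul_one]
  rfl

theorem pointMasses_eq_zero {x : ℕ → K} (c : ℝ≥0) {s : Finset ℕ} {A : Set K}
    (hA : MeasurableSet A) (h : ∀ i ∈ s, x i ∉ A) : pointMasses x c s A = 0 := by
  simp only [pointMasses, Measure.smul_apply, Measure.finsetSum_apply]
  rw [Finset.sum_eq_zero fun i hi => by simp [Measure.dirac_apply' _ hA, h i hi], smul_zero]

theorem pointMasses_add_union (x : ℕ → K) (c : ℝ≥0) {s t : Finset ℕ} (h : Disjoint s t) :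
    pointMasses x c s + pointMasses x c t = pointMasses x c (s ∪ t) := by
  simp [pointMasses, Finset.sum_union h]

variable [MeasurableSingletonClass K]

theorem integral_pointMasses (x : ℕ → K) (c : ℝ≥0) (s : Finset ℕ) (f : K → ℝ) :
    ∫ k, f k ∂pointMasses x c s = c * ∑ i ∈ s, f (x i) := by
  rw [pointMasses, integral_smul_nnreal_measure, integral_finsetSum_measure]
  · simp [NNReal.smul_def]
  · exact fun i _ => integrable_dirac (by simp)

theorem pointMasses_mutuallySingular {x : ℕ → K} (hinj : Function.Injective x) (c : ℝ≥0)
    {s t : Finset ℕ} (h : Disjoint s t) :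
    Measure.MutuallySingular (pointMasses x c s) (pointMasses x c t) := by
  have ht : MeasurableSet (x '' t) := (t.finite_toSet.image x).measurableSet
  refine ⟨x '' t, ht, pointMasses_eq_zero c ht fun i hi => ?_,
    pointMasses_eq_zero c ht.compl fun i hi => ?_⟩
  · rintro ⟨j, hj, hij⟩
    exact Finset.disjoint_left.1 h hi (hinj hij ▸ hj)
  · exact fun hn => hn (mem_image_of_mem x hi)

/-- The Jordan decomposition whose parts put mass `c` at each of the points indexed by two
disjoint finite sets. -/
noncomputable def pointJordan {x : ℕ → K} (hinj : Function.Injective x) (c : ℝ≥0)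
    {s t : Finset ℕ} (h : Disjoint s t) : JordanDecomposition K where
  posPart := pointMasses x c s
  negPart := pointMasses x c t
  mutuallySingular := pointMasses_mutuallySingular hinj c h

theorem totalVariation_pointJordan {x : ℕ → K} (hinj : Function.Injective x) (c : ℝ≥0)
    {s t : Finset ℕ} (h : Disjoint s t) :
    (pointJordan hinj c h).toSignedMeasure.totalVariation = pointMasses x c (s ∪ t) := by
  rw [SignedMeasure.totalVariation, JordanDecomposition.toJordanDecomposition_toSignedMeasure]
  exact pointMasses_add_union x c h

end

theorem innerRegular_dirac {K : Type*} [TopologicalSpace K] [MeasurableSpace K] (a : K) :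
    (Measure.dirac a).InnerRegular where
  innerRegular := by
    intro U hU r hr
    rw [Measure.dirac_apply' _ hU] at hr
    have ha : a ∈ U := by
      by_contra ha
      simp [ha] at hr
    exact ⟨{a}, by simpa using ha, isCompact_singleton, by simpa [ha] using hr⟩

theorem regular_pointMasses {K : Type*} [TopologicalSpace K] [MeasurableSpace K] [BorelSpace K]
    [T2Space K] (x : ℕ → K) (c : ℝ≥0) (s : Finset ℕ) : (pointMasses x c s).Regular := by
  have := fun i => innerRegular_dirac (x i)
  have : (pointMasses x c s).InnerRegular := by
    unfold pointMasses
    infer_instance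
  infer_instance

end JNP

/-- If a Radon probability measure `μ` on a compact Hausdorff space `K` admits a uniformly
distributed injective sequence, then `K` has the finitely supported Josefson–Nissenzweig
property. -/
theorem stmt_13 {K : Type*} [TopologicalSpace K] [MeasurableSpace K] [BorelSpace K]
    [CompactSpace K] [T2Space K]
    (μ : MeasureTheory.Measure K) [MeasureTheory.IsProbabilityMeasure μ] [μ.Regular]
    (x : ℕ → K) (hinj : Function.Injective x)
    (hud : ∀ f : C(K, ℝ),
      Filter.Tendsto (fun n : ℕ => (∑ i ∈ Finset.range n, f (x i)) / (n : ℝ))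
        Filter.atTop (nhds (∫ k, f k ∂μ))) :
    JNP.fsJNP K := by
  have hd (N : ℕ) : Disjoint (Finset.Ico N (2 * N)) (Finset.range N) := by
    rw [Finset.disjoint_left]
    intro i hi
    simp_all
  have hu (N : ℕ) : Finset.Ico N (2 * N) ∪ Finset.range N = Finset.range (2 * N) := by
    ext i
    simp only [Finset.mem_union, Finset.mem_Ico, Finset.mem_range]
    omega
  -- The differences of the averages of lengths `2N` and `N`, where `N = n + 1`.
  refine ⟨fun n => (JNP.pointJordan hinj (2 * (n + 1 : ℕ))⁻¹ (hd (n + 1))).toSignedMeasure,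
    fun n => ?_, fun n => ?_, fun n => ?_, fun f => ?_⟩
  · rw [JNP.IsRadon, JNP.totalVariation_pointJordan]
    exact JNP.regular_pointMasses _ _ _
  · refine ((Finset.range (2 * (n + 1))).finite_toSet.image x).subset fun k hk => ?_
    by_contra hkx
    have hc := ((Finset.range (2 * (n + 1))).finite_toSet.image x).isClosed.isOpen_compl
    refine hk _ hc hkx ?_
    rw [JNP.totalVariation_pointJordan, hu]
    exact JNP.pointMasses_eq_zero _ hc.measurableSet fun i hi hn => hn (mem_image_of_mem x hi)
  · rw [JNP.tvNorm, JNP.totalVariation_pointJordan, hu, JNP.pointMasses_univ]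
    simp only [ENNReal.toReal_mul, ENNReal.coe_toReal, Finset.card_range, ENNReal.toReal_natCast]
    push_cast
    field_simp
  · have h1 : Tendsto (fun n : ℕ => n + 1) atTop atTop := tendsto_add_atTop_nat 1
    have h2 : Tendsto (fun n : ℕ => 2 * (n + 1)) atTop atTop :=
      tendsto_atTop_mono (fun n => by omega) h1
    have h := ((hud f).comp h2).sub ((hud f).comp h1)
    rw [sub_self] at h
    refine h.congr fun n => ?_
    simp only [JNP.integ, JordanDecomposition.toJordanDecomposition_toSignedMeasure,
      JNP.pointJordan, JNP.integral_pointMasses, Function.comp_apply]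
    rw [← hu, Finset.sum_union (hd _)]
    push_cast
    field_simp
    ring
end

section
/- Let π : K → L be a simple extension between totally disconnected compact Hausdorff spaces with distinguished point x₀ ∈ L (so that π⁻¹(x₀) has exactly two elements and all other fibers are singletons). Then for every subset X ⊆ K, the set ∂π[X] \ π[∂X] is contained in {x₀}, where ∂ denotes the topological boundary. -/
open Set

/-- A point with a one-point fiber under a closed continuous surjection that lies in the boundary
of the image of `X` is the image of a boundary point of `X`. -/
theorem IsClosedMap.mem_image_frontier_of_existsUnique {K L : Type*} [TopologicalSpace K]
    [TopologicalSpace L] {f : K → L} (hclosed : IsClosedMap f) (hcont : Continuous f)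
    (hsurj : Function.Surjective f) {X : Set K} {y : L} (hy : y ∈ frontier (f '' X))
    (hfib : ∃! z, f z = y) : y ∈ f '' frontier X := by
  obtain ⟨z, rfl, huniq⟩ := hfib
  refine ⟨z, ⟨?_, fun hz => hy.2 ?_⟩, rfl⟩
  · obtain ⟨w, hw, hwz⟩ := (hclosed.closure_image_eq_of_continuous hcont X).subset hy.1
    exact huniq w hwz ▸ hw
  · refine mem_interior.2 ⟨(f '' (interior X)ᶜ)ᶜ, fun t ht => ?_,
      (hclosed _ isOpen_interior.isClosed_compl).isOpen_compl, ?_⟩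
    · obtain ⟨w, rfl⟩ := hsurj t
      exact ⟨w, interior_subset (by_contra fun hw => ht ⟨w, hw, rfl⟩), rfl⟩
    · rintro ⟨w, hw, hwz⟩
      exact hw (huniq w hwz ▸ hz)

/-- If `π : K → L` is a simple extension of totally disconnected compact Hausdorff spaces with
distinguished point `x₀` (the fiber over `x₀` has exactly two elements and all other fibers are
singletons), then for every `X ⊆ K` we have `∂π[X] \ π[∂X] ⊆ {x₀}`. -/
theorem stmt_15 {K L : Type*} [TopologicalSpace K] [TopologicalSpace L]
    [CompactSpace K] [CompactSpace L] [T2Space K] [T2Space L]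
    [TotallyDisconnectedSpace K] [TotallyDisconnectedSpace L]
    (π : K → L) (hcont : Continuous π) (hsurj : Function.Surjective π)
    (x₀ : L) (hfib : (π ⁻¹' {x₀}).ncard = 2)
    (hsingle : ∀ y : L, y ≠ x₀ → ∃! z : K, π z = y) :
    ∀ X : Set K, frontier (π '' X) \ π '' frontier X ⊆ {x₀} := by
  rintro X y ⟨hy, hny⟩
  by_contra hne
  exact hny (hcont.isClosedMap.mem_image_frontier_of_existsUnique hcont hsurj hy (hsingle y hne))
end

section
/- Let 2^ω denote the Cantor space and λ the standard product probability measure on 2^ω. For n ∈ ω, s ∈ 2^n and i ∈ {0,1}, let x_s^i = s⌢(i,i,i,…) ∈ 2^ω denote the extension of s by the constant sequence i. Let Y be a totally disconnected compact Hausdorff space and f : Y → 2^ω a continuous surjection such that λ(f[U] ∩ f[Y \ U]) = 0 for every clopen subset U of Y. For every n, i ∈ {0,1} and s ∈ 2^n choose a point y_s^i ∈ f⁻¹(x_s^i), and define ν_n = (1/2^{n+1}) Σ_{s ∈ 2^n} (δ_{y_s^1} − δ_{y_s^0}). Then ⟨ν_n⟩ is a finitely supported Josefson–Nissenzweig sequence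 on Y: each ν_n is finitely supported with total variation norm 1, and ∫_Y g dν_n → 0 for every continuous g : Y → ℝ. -/
open MeasureTheory Filter Topology Set
open scoped ENNReal

open scoped NNReal

/-- The Jordan decomposition of `c • ∑ i, (δ_{p i} - δ_{q i})` when no `p i` equals any `q j`. -/
noncomputable def diracSumJordan {Y ι : Type*} [MeasurableSpace Y] [MeasurableSingletonClass Y]
    [Fintype ι] (p q : ι → Y) (hpq : ∀ i j, p i ≠ q j) (c : ℝ≥0) : JordanDecomposition Y where
  posPart := c • ∑ i, Measure.dirac (p i)
  negPart := c • ∑ i, Measure.dirac (q i)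
  mutuallySingular := by
    refine ⟨range q, (finite_range q).measurableSet, ?_, ?_⟩
    · have h : ∀ i, p i ∉ range q := fun i ⟨j, hj⟩ => hpq i j hj.symm
      simp [Measure.dirac_apply' _ (finite_range q).measurableSet, h]
    · simp [Measure.dirac_apply' _ (finite_range q).measurableSet.compl]

theorem toJordanDecomposition_smul_sum_dirac_sub {Y ι : Type*} [MeasurableSpace Y]
    [MeasurableSingletonClass Y] [Fintype ι] (p q : ι → Y) (hpq : ∀ i j, p i ≠ q j) (c : ℝ≥0) :
    ((c : ℝ) • ∑ i, ((Measure.dirac (p i)).toSignedMeasure -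
      (Measure.dirac (q i)).toSignedMeasure)).toJordanDecomposition =
      diracSumJordan p q hpq c := by
  rw [← JordanDecomposition.toJordanDecomposition_toSignedMeasure (diracSumJordan p q hpq c)]
  congr 1
  ext A hA
  have hsum : ∀ u : ι → Y, (∑ i, Measure.dirac (u i)).real A =
      ∑ i, (Measure.dirac (u i)).real A := fun u => by
    simp only [Measure.real, Measure.finsetSum_apply]
    exact ENNReal.toReal_sum fun i _ => measure_ne_top _ _
  rw [JordanDecomposition.toSignedMeasure, Measure.toSignedMeasure_sub_apply hA]
  simp only [diracSumJordan, measureReal_nnreal_smul_apply, hsum, _root_.smul_apply,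
    ← FunLike.coeAddMonoidHom_apply, map_sum, Finset.sum_apply]
  simp only [FunLike.coeAddMonoidHom_apply, _root_.sub_apply,
    Measure.toSignedMeasure_apply_measurable hA, Finset.sum_sub_distrib, smul_eq_mul]
  ring

theorem regular_of_finite_compl_null {Y : Type*} [TopologicalSpace Y] [T1Space Y]
    [MeasurableSpace Y] [BorelSpace Y] (μ : Measure Y) [IsFiniteMeasure μ] {F : Set Y}
    (hF : F.Finite) (hμ : μ Fᶜ = 0) : μ.Regular where
  outerRegular A _ r hr := by
    refine ⟨(F \ A)ᶜ, fun x hx h => h.2 hx, (hF.subset sdiff_subset).isClosed.isOpen_compl,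
      lt_of_le_of_lt ?_ hr⟩
    calc μ (F \ A)ᶜ ≤ μ (A ∪ Fᶜ) := measure_mono fun x hx => by
          by_cases h : x ∈ F
          · exact Or.inl (by_contra fun h' => hx ⟨h, h'⟩)
          · exact Or.inr h
      _ ≤ μ A + μ Fᶜ := measure_union_le _ _
      _ = μ A := by rw [hμ, add_zero]
  innerRegular U _ r hr := by
    refine ⟨U ∩ F, inter_subset_left, (hF.subset inter_subset_right).isCompact,
      lt_of_lt_of_le hr ?_⟩
    calc μ U ≤ μ (U ∩ F ∪ Fᶜ) := measure_mono fun x hx => by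
          by_cases h : x ∈ F
          · exact Or.inl ⟨hx, h⟩
          · exact Or.inr h
      _ ≤ μ (U ∩ F) + μ Fᶜ := measure_union_le _ _
      _ = μ (U ∩ F) := by rw [hμ, add_zero]

/-- The finite sequences of length `n` having extensions both in `A` and in `B`. -/
def commonPrefixes (A B : Set (ℕ → Bool)) (n : ℕ) : Set (Fin n → Bool) :=
  {s | (∃ a ∈ A, ∀ i : Fin n, a i = s i) ∧ ∃ b ∈ B, ∀ i : Fin n, b i = s i}

theorem mem_of_forall_exists_prefix {A : Set (ℕ → Bool)} (hA : IsClosed A) {x : ℕ → Bool}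
    (hx : ∀ n, ∃ a ∈ A, ∀ i : Fin n, a i = x i) : x ∈ A := by
  choose a haA ha using hx
  refine hA.mem_of_tendsto (b := atTop) (f := a) ?_ (Eventually.of_forall haA)
  rw [tendsto_pi_nhds]
  intro k
  refine tendsto_const_nhds.congr' ?_
  filter_upwards [eventually_gt_atTop k] with n hn
  exact (ha n ⟨k, hn⟩).symm

theorem tendsto_ncard_commonPrefixes (lam : Measure (ℕ → Bool)) [IsProbabilityMeasure lam]
    (hlam : ∀ (n : ℕ) (s : Fin n → Bool),
      lam {x : ℕ → Bool | ∀ i : Fin n, x i.val = s i} = (1 / 2 : ℝ≥0∞) ^ n)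
    {A B : Set (ℕ → Bool)} (hA : IsClosed A) (hB : IsClosed B) (h : lam (A ∩ B) = 0) :
    Tendsto (fun n => ((commonPrefixes A B n).ncard : ℝ) / 2 ^ n) atTop (𝓝 0) := by
  set r : ∀ n, (ℕ → Bool) → (Fin n → Bool) := fun n x i => x i with hr
  have hrm : ∀ n, Measurable (r n) := fun n => by
    rw [measurable_pi_iff]; intro i; exact measurable_pi_apply _
  set D : ℕ → Set (ℕ → Bool) := fun n => r n ⁻¹' commonPrefixes A B n with hD
  have hDm : ∀ n, MeasurableSet (D n) := fun n => hrm n (Set.toFinite _).measurableSet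
  have hanti : Antitone D := by
    rintro m n hmn x ⟨⟨a, haA, ha⟩, b, hbB, hb⟩
    exact ⟨⟨a, haA, fun i => ha (Fin.castLE hmn i)⟩, b, hbB, fun i => hb (Fin.castLE hmn i)⟩
  have hinter : ⋂ n, D n ⊆ A ∩ B := by
    intro x hx
    rw [mem_iInter] at hx
    exact ⟨mem_of_forall_exists_prefix hA fun n => (hx n).1,
      mem_of_forall_exists_prefix hB fun n => (hx n).2⟩
  have hlim : Tendsto (fun n => lam.real (D n)) atTop (𝓝 0) := by
    have := tendsto_measure_iInter_atTop (μ := lam) (fun n => (hDm n).nullMeasurableSet) hanti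
      ⟨0, measure_ne_top _ _⟩
    rw [measure_mono_null hinter h] at this
    simpa [Measure.real, Function.comp_def] using
      (ENNReal.tendsto_toReal ENNReal.zero_ne_top).comp this
  refine hlim.congr fun n => ?_
  have hfiber : ∀ s : Fin n → Bool, lam.real (r n ⁻¹' {s}) = (1 / 2 : ℝ) ^ n := fun s => by
    have : r n ⁻¹' {s} = {x : ℕ → Bool | ∀ i : Fin n, x i.val = s i} := by
      ext x; simp [hr, funext_iff]
    rw [this, Measure.real, hlam]
    simp
  have hfin := Set.toFinite (commonPrefixes A B n)
  have hDeq : D n = ⋃ s ∈ hfin.toFinset, r n ⁻¹' {s} := by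
    ext x; simp [hD]
  rw [hDeq, measureReal_biUnion_finset]
  · simp only [hfiber, Finset.sum_const, nsmul_eq_mul, ncard_eq_toFinset_card _ hfin]
    rw [one_div, inv_pow, div_eq_mul_inv]
  · intro s _ t _ hst
    exact (disjoint_singleton.2 hst).preimage _
  · intro s _
    exact hrm n (measurableSet_singleton s)

theorem exists_finset_isClopen_cover {Y : Type*} [TopologicalSpace Y] [CompactSpace Y] [T2Space Y]
    [TotallyDisconnectedSpace Y] (g : C(Y, ℝ)) {ε : ℝ} (hε : 0 < ε) :
    ∃ (t : Finset Y) (V : Y → Set Y), (∀ z, IsClopen (V z)) ∧ (∀ x, ∃ z ∈ t, x ∈ V z) ∧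
      ∀ z, ∀ x ∈ V z, ∀ x' ∈ V z, |g x - g x'| < ε := by
  have key : ∀ z : Y, ∃ V : Set Y, IsClopen V ∧ z ∈ V ∧ V ⊆ g ⁻¹' Metric.ball (g z) (ε / 2) :=
    fun z => compact_exists_isClopen_in_isOpen (Metric.isOpen_ball.preimage g.continuous)
      (Metric.mem_ball_self (half_pos hε))
  choose V hV hzV hVsub using key
  obtain ⟨t, ht⟩ := CompactSpace.elim_nhds_subcover V fun z => (hV z).isOpen.mem_nhds (hzV z)
  refine ⟨t, V, hV, fun x => ?_, fun z x hx x' hx' => ?_⟩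
  · have : x ∈ ⋃ z ∈ t, V z := ht ▸ mem_univ x
    simpa using this
  · have h1 := hVsub z hx
    have h2 := hVsub z hx'
    simp only [mem_preimage, Metric.mem_ball, Real.dist_eq, abs_lt] at h1 h2 ⊢
    constructor <;> linarith [h1.1, h1.2, h2.1, h2.2]

/-- If `|g (p s) - g (q s)| ≤ ε` for all `s` outside `E`, then the sum of the differences is bounded
by `ε` times the number of indices plus `2 ‖g‖` times the size of `E`. -/
theorem abs_average_sub_le {Y ι : Type*} [TopologicalSpace Y] [CompactSpace Y] [Fintype ι]
    (g : C(Y, ℝ)) (p q : ι → Y) {ε : ℝ} (hε : 0 ≤ ε) (E : Finset ι)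
    (hE : ∀ s ∉ E, |g (p s) - g (q s)| ≤ ε) :
    |∑ s, (g (p s) - g (q s))| ≤ Fintype.card ι * ε + E.card * (2 * ‖g‖) := by
  classical
  have hg : ∀ s, |g (p s) - g (q s)| ≤ 2 * ‖g‖ := fun s => by
    have h1 := g.norm_coe_le_norm (p s)
    have h2 := g.norm_coe_le_norm (q s)
    rw [Real.norm_eq_abs] at h1 h2
    linarith [abs_sub (g (p s)) (g (q s))]
  calc |∑ s, (g (p s) - g (q s))| ≤ ∑ s, |g (p s) - g (q s)| := Finset.abs_sum_le_sum_abs _ _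
    _ ≤ ∑ s, (ε + if s ∈ E then 2 * ‖g‖ else 0) := by
        refine Finset.sum_le_sum fun s _ => ?_
        split_ifs with h
        · linarith [hg s]
        · linarith [hE s h]
    _ = Fintype.card ι * ε + E.card * (2 * ‖g‖) := by
        simp [Finset.sum_add_distrib, Finset.sum_ite_mem]

/-- Proposition 6.10: let `λ` be the standard product measure on the Cantor space `2^ω`,
`Y` a totally disconnected compact Hausdorff space and `f : Y → 2^ω` a continuous surjection
with `λ(f[U] ∩ f[Y \ U]) = 0` for every clopen `U ⊆ Y`. For `s ∈ 2^n` and `i ∈ 2` pick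
`y s i ∈ f⁻¹(x_s^i)`, where `x_s^i = s⌢(i,i,…)`. Then the measures
`ν_n = 2^{-(n+1)} ∑_{s ∈ 2^n} (δ_{y_s^1} - δ_{y_s^0})` form a finitely supported
Josefson–Nissenzweig sequence on `Y`. -/
theorem stmt_18 {Y : Type*} [TopologicalSpace Y] [MeasurableSpace Y] [BorelSpace Y]
    [CompactSpace Y] [T2Space Y] [TotallyDisconnectedSpace Y]
    (lam : MeasureTheory.Measure (ℕ → Bool)) [MeasureTheory.IsProbabilityMeasure lam]
    (hlam : ∀ (n : ℕ) (s : Fin n → Bool),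
      lam {x : ℕ → Bool | ∀ i : Fin n, x i.val = s i} = (1 / 2 : ℝ≥0∞) ^ n)
    (f : Y → (ℕ → Bool)) (hcont : Continuous f) (hsurj : Function.Surjective f)
    (hnull : ∀ U : Set Y, IsClopen U → lam (f '' U ∩ f '' Uᶜ) = 0)
    (y : ∀ (n : ℕ), (Fin n → Bool) → Bool → Y)
    (hy : ∀ (n : ℕ) (s : Fin n → Bool) (i : Bool),
      f (y n s i) = fun k : ℕ => if h : k < n then s ⟨k, h⟩ else i)
    (ν : ℕ → MeasureTheory.SignedMeasure Y)
    (hν : ∀ n : ℕ, ν n = ((1 : ℝ) / 2 ^ (n + 1)) • ∑ s : Fin n → Bool,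
      ((MeasureTheory.Measure.dirac (y n s true)).toSignedMeasure -
        (MeasureTheory.Measure.dirac (y n s false)).toSignedMeasure)) :
    (∀ n, JNP.IsRadon (ν n)) ∧ (∀ n, (JNP.msupport (ν n)).Finite) ∧
      (∀ n, JNP.tvNorm (ν n) = 1) ∧ JNP.WeakStarNull ν := by
  have hpq : ∀ (n : ℕ) (s t : Fin n → Bool), y n s true ≠ y n t false := fun n s t h => by
    have := congrFun (congrArg f h) n
    simp [hy] at this
  set c : ℕ → ℝ≥0 := fun n => 1 / 2 ^ (n + 1) with hc
  have hJ : ∀ n, (ν n).toJordanDecomposition =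
      diracSumJordan (fun s => y n s true) (fun s => y n s false) (hpq n) (c n) := fun n => by
    rw [← toJordanDecomposition_smul_sum_dirac_sub, hν n]
    simp [hc]
  have hTV : ∀ n, (ν n).totalVariation = c n • ∑ s, Measure.dirac (y n s true) +
      c n • ∑ s, Measure.dirac (y n s false) := fun n => by
    rw [SignedMeasure.totalVariation, hJ]
    rfl
  set F : ∀ n : ℕ, Set Y := fun n => range fun z : (Fin n → Bool) × Bool => y n z.1 z.2 with hF
  have hFfin : ∀ n, (F n).Finite := fun n => finite_range _
  have hFnull : ∀ n, (ν n).totalVariation (F n)ᶜ = 0 := fun n => by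
    have hmem : ∀ s i, y n s i ∈ F n := fun s i => ⟨(s, i), rfl⟩
    simp [hTV, Measure.dirac_apply' _ (hFfin n).measurableSet.compl, hmem]
  have hinteg : ∀ (g : C(Y, ℝ)) n, JNP.integ (ν n) g =
      (1 / 2 ^ (n + 1)) * ∑ s, (g (y n s true) - g (y n s false)) := fun g n => by
    have hsum : ∀ u : (Fin n → Bool) → Y,
        ∫ x, g x ∂(c n • ∑ s, Measure.dirac (u s)) = (1 / 2 ^ (n + 1)) * ∑ s, g (u s) := fun u => by
      rw [integral_smul_nnreal_measure, integral_finsetSum_measure]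
      · simp [hc, NNReal.smul_def]
      · intro s _
        exact integrable_dirac (by simp)
    rw [JNP.integ, hJ]
    simp only [diracSumJordan, hsum, Finset.sum_sub_distrib]
    ring
  refine ⟨fun n => ?_, fun n => ?_, fun n => ?_, fun g => ?_⟩
  · exact regular_of_finite_compl_null _ (hFfin n) (hFnull n)
  · refine (hFfin n).subset fun x hx => by_contra fun hxF => ?_
    exact hx _ (hFfin n).isClosed.isOpen_compl hxF (hFnull n)
  · have h2 : (c n : ℝ) * 2 ^ n + c n * 2 ^ n = 1 := by
      simp only [hc]
      push_cast
      field_simp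
      ring
    rw [JNP.tvNorm, hTV, Measure.add_apply, Measure.smul_apply, Measure.smul_apply,
      Measure.finsetSum_apply, Measure.finsetSum_apply, ENNReal.toReal_add]
    · simpa [ENNReal.toReal_smul, NNReal.smul_def] using h2
    · simp [ENNReal.smul_def, ENNReal.mul_eq_top]
    · simp [ENNReal.smul_def, ENNReal.mul_eq_top]
  · rw [Metric.tendsto_atTop']
    intro ε hε
    obtain ⟨t, V, hV, hcover, hosc⟩ := exists_finset_isClopen_cover g hε
    set b : Y → ∀ n : ℕ, Set (Fin n → Bool) :=
      fun z => commonPrefixes (f '' V z) (f '' (V z)ᶜ) with hb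
    have hlim : Tendsto (fun n => (∑ z ∈ t, ((b z n).ncard : ℝ) / 2 ^ n) * ‖g‖) atTop (𝓝 0) := by
      have hz : ∀ z ∈ t, Tendsto (fun n => ((b z n).ncard : ℝ) / 2 ^ n) atTop (𝓝 0) := fun z _ =>
        tendsto_ncard_commonPrefixes lam hlam
          ((hV z).isClosed.isCompact.image hcont).isClosed
          ((hV z).compl.isClosed.isCompact.image hcont).isClosed (hnull _ (hV z))
      simpa using (tendsto_finsetSum t hz).mul_const ‖g‖
    obtain ⟨N, hN⟩ := eventually_atTop.1 (hlim.eventually (gt_mem_nhds (half_pos hε)))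
    refine ⟨N, fun n hn => ?_⟩
    classical
    have hprefix : ∀ s i, ∀ j : Fin n, f (y n s i) j = s j := fun s i j => by simp [hy]
    set E : Finset (Fin n → Bool) := t.biUnion fun z => (Set.toFinite (b z n)).toFinset with hE
    have hgood : ∀ s ∉ E, |g (y n s true) - g (y n s false)| ≤ ε := fun s hs => by
      obtain ⟨z, hzt, hz⟩ := hcover (y n s true)
      have hsb : s ∉ b z n := fun h => hs (by
        simp only [hE, Finset.mem_biUnion, Finite.mem_toFinset]
        exact ⟨z, hzt, h⟩)
      refine (hosc z _ hz _ (by_contra fun hz' => hsb ?_)).le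
      exact ⟨⟨_, mem_image_of_mem f hz, hprefix s true⟩, _, mem_image_of_mem f hz',
        hprefix s false⟩
    have hEcard : (E.card : ℝ) ≤ ∑ z ∈ t, ((b z n).ncard : ℝ) := by
      have := Finset.card_biUnion_le (s := t) (t := fun z => (Set.toFinite (b z n)).toFinset)
      simp only [← ncard_eq_toFinset_card] at this
      exact_mod_cast this
    have hbound := abs_average_sub_le g (fun s => y n s true) (fun s => y n s false) hε.le E hgood
    have hN' := hN n hn.le
    rw [dist_zero_right, hinteg, Real.norm_eq_abs, abs_mul, abs_of_pos (by positivity)]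
    have hcard : (Fintype.card (Fin n → Bool) : ℝ) = 2 ^ n := by simp
    rw [hcard] at hbound
    rw [← Finset.sum_div] at hN'
    calc 1 / 2 ^ (n + 1) * |∑ s, (g (y n s true) - g (y n s false))|
        ≤ 1 / 2 ^ (n + 1) * (2 ^ n * ε + (∑ z ∈ t, ((b z n).ncard : ℝ)) * (2 * ‖g‖)) := by
          gcongr
          exact hbound.trans (by gcongr)
      _ = ε / 2 + (∑ z ∈ t, ((b z n).ncard : ℝ)) / 2 ^ n * ‖g‖ := by
          field_simp
          ring
      _ < ε := by linarith
end
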